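/- (All prior densities of the greedy quantized-control scheme are log-concave) Let g be a log-concave probability density on ℝ and let a ≠ 0. Define a sequence of functions recursively by f_1 = g and, for each t ≥ 1, given any interval I_t ⊆ ℝ with γ_t = ∫_{I_t} f_t(s) ds > 0 and any real number u_t, set f_{t+1}(x) = ∫_ℝ γ_t^{−1} 1_{I_t}(s) f_t(s) g(x − a·s − u_t) ds. Then for every t ≥ 1 and every choice of intervals I_1, …, I_{t−1} and reals u_1, …, u_{t−1}, the function f_t is a log-concave probability density on ℝ. -/

import Mathlib

open MeasureTheory

/-- A function `f : ℝ → [0, ∞)` is log-concave if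
`f (λx + (1 − λ)y) ≥ f x ^ λ * f y ^ (1 − λ)` for all `x, y ∈ ℝ` and `λ ∈ [0, 1]`,
where `^` denotes the real power. -/
def LogConcave (f : ℝ → ℝ) : Prop :=
  ∀ x y l : ℝ, 0 ≤ l → l ≤ 1 →
    f x ^ l * f y ^ (1 - l) ≤ f (l * x + (1 - l) * y)

open scoped Pointwise

theorem bm_one {A B C : Set ℝ} (hA : MeasurableSet A) (hB : MeasurableSet B)
    (hA0 : A.Nonempty) (hB0 : B.Nonempty)
    (hC : ∀ a ∈ A, ∀ b ∈ B, a + b ∈ C) : volume A + volume B ≤ volume C := by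
  have key : ∀ K L : Set ℝ, IsCompact K → IsCompact L → K.Nonempty → L.Nonempty →
      K ⊆ A → L ⊆ B → volume K + volume L ≤ volume C := by
    intro K L hK hL hK0 hL0 hKA hLB
    obtain ⟨p, hp, hpm⟩ := hK.exists_isGreatest hK0
    obtain ⟨q, hq, hqm⟩ := hL.exists_isLeast hL0
    have e1 : volume ((fun x => x + -q) ⁻¹' K) = volume K := measure_preimage_add_right _ _ _
    have e2 : volume ((fun x => x + -p) ⁻¹' (L \ {q})) = volume L := by
      rw [measure_preimage_add_right]
      exact measure_sdiff_null (by simp)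
    rw [← e1, ← e2, ← measure_union]
    · apply measure_mono
      rintro x (hx | hx)
      · have := hC _ (hKA hx) _ (hLB hq)
        simpa using this
      · have := hC _ (hKA hp) _ (hLB hx.1)
        simpa using this
    · rw [Set.disjoint_left]
      intro x hx hx2
      have h1 := hpm hx
      have h2 := hqm hx2.1
      have h3 : x + -p ≠ q := fun h => hx2.2 h
      apply h3
      apply le_antisymm _ h2
      simp only at h1
      linarith
    · exact (measurable_id.add_const (-p)) (hL.measurableSet.diff (measurableSet_singleton q))
  obtain ⟨a0, ha0⟩ := hA0
  obtain ⟨b0, hb0⟩ := hB0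
  rw [hA.measure_eq_iSup_isCompact, hB.measure_eq_iSup_isCompact]
  simp only [iSup_and']
  have key2 : ∀ K L : Set ℝ, IsCompact K → IsCompact L → 
      K ⊆ A → L ⊆ B → volume K + volume L ≤ volume C := by
    intro K L hK hL hKA hLB
    refine le_trans ?_ (key (insert a0 K) (insert b0 L) (hK.insert _) (hL.insert _)
      (Set.insert_nonempty _ _) (Set.insert_nonempty _ _) (Set.insert_subset ha0 hKA)
      (Set.insert_subset hb0 hLB))
    gcongr <;> exact Set.subset_insert _ _
  have hne : ∀ S : Set ℝ, Nonempty {K : Set ℝ // K ⊆ S ∧ IsCompact K} :=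
    fun S => ⟨⟨∅, by simp⟩⟩
  have r : ∀ S : Set ℝ, (⨆ K, ⨆ (_ : K ⊆ S ∧ IsCompact K), volume K) =
     ⨆ K : {K : Set ℝ // K ⊆ S ∧ IsCompact K}, volume K.1 := by
    intro S; rw [iSup_subtype]
  rw [r, r]
  have := hne A
  have := hne B
  refine ENNReal.iSup_add_iSup_le ?_
  rintro ⟨K, hK1, hK2⟩ ⟨L, hL1, hL2⟩
  exact key2 K L hK2 hL2 hK1 hL1

theorem pl_norm {f g h : ℝ → ℝ} (hf : Measurable f) (hg : Measurable g) (hh : Measurable h)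
    (hf0 : ∀ x, 0 ≤ f x) (hg0 : ∀ x, 0 ≤ g x) (hh0 : ∀ x, 0 ≤ h x)
    (hf1 : ∀ x, f x ≤ 1) (hg1 : ∀ x, g x ≤ 1)
    (hfs : ∀ t < 1, ∃ x, t < f x) (hgs : ∀ t < 1, ∃ x, t < g x)
    (l : ℝ) (hl0 : 0 < l) (hl1 : l < 1)
    (H : ∀ x y, f x ^ l * g y ^ (1 - l) ≤ h (l * x + (1 - l) * y)) :
    ENNReal.ofReal l * (∫⁻ x, ENNReal.ofReal (f x)) +
      ENNReal.ofReal (1 - l) * (∫⁻ x, ENNReal.ofReal (g x)) ≤ ∫⁻ x, ENNReal.ofReal (h x) := by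
  have hl1' : 0 < 1 - l := by linarith
  rw [lintegral_eq_lintegral_meas_lt _ (.of_forall hf0) hf.aemeasurable,
    lintegral_eq_lintegral_meas_lt _ (.of_forall hg0) hg.aemeasurable,
    lintegral_eq_lintegral_meas_lt _ (.of_forall hh0) hh.aemeasurable,
    ← lintegral_const_mul' _ _ ENNReal.ofReal_ne_top,
    ← lintegral_const_mul' _ _ ENNReal.ofReal_ne_top, ← lintegral_add_left]
  swap
  · refine Measurable.const_mul ?_ _
    exact Antitone.measurable (fun s t hst => measure_mono fun x hx => lt_of_le_of_lt hst hx)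
  refine setLIntegral_mono' measurableSet_Ioi ?_
  intro t ht
  have ht : 0 < t := ht
  rcases lt_or_ge t 1 with h1 | h1
  · have hA : MeasurableSet {x | t < f x} := measurableSet_lt measurable_const hf
    have hB : MeasurableSet {x | t < g x} := measurableSet_lt measurable_const hg
    have hA' : MeasurableSet (l • {x | t < f x}) := hA.const_smul₀ l
    have hB' : MeasurableSet ((1 - l) • {x | t < g x}) := hB.const_smul₀ (1 - l)
    have := bm_one (C := {x | t < h x}) hA' hB' (Set.Nonempty.smul_set (hfs t h1)) (Set.Nonempty.smul_set (hgs t h1)) ?_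
    · rw [Measure.addHaar_smul, Measure.addHaar_smul] at this
      simpa [abs_of_pos hl0, abs_of_pos hl1'] using this
    · rintro _ ⟨x, hx, rfl⟩ _ ⟨y, hy, rfl⟩
      simp only [Set.mem_setOf_eq, smul_eq_mul] at *
      refine lt_of_lt_of_le ?_ (H x y)
      have e : t = t ^ l * t ^ (1 - l) := by
        rw [← Real.rpow_add ht]; simp
      calc t = t ^ l * t ^ (1 - l) := e
        _ < f x ^ l * g y ^ (1 - l) := by
          apply mul_lt_mul''
          · exact Real.rpow_lt_rpow ht.le hx hl0
          · exact Real.rpow_lt_rpow ht.le hy hl1'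
          · positivity
          · positivity
  · have e1 : {x | t < f x} = ∅ := by
      ext x; simpa using (hf1 x).trans h1
    have e2 : {x | t < g x} = ∅ := by
      ext x; simpa using (hg1 x).trans h1
    simp [e1, e2]

theorem pl_int {f g h : ℝ → ℝ} (hf : Measurable f) (hg : Measurable g) (hh : Measurable h)
    (hf0 : ∀ x, 0 ≤ f x) (hg0 : ∀ x, 0 ≤ g x) (hh0 : ∀ x, 0 ≤ h x)
    (hfi : Integrable f) (hgi : Integrable g) (hhi : Integrable h)
    (hfb : BddAbove (Set.range f)) (hgb : BddAbove (Set.range g))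
    (l : ℝ) (hl0 : 0 < l) (hl1 : l < 1)
    (H : ∀ x y, f x ^ l * g y ^ (1 - l) ≤ h (l * x + (1 - l) * y)) :
    (∫ x, f x) ^ l * (∫ x, g x) ^ (1 - l) ≤ ∫ x, h x := by
  have hl1' : 0 < 1 - l := by linarith
  have hI : 0 ≤ ∫ x, h x := integral_nonneg hh0
  have sup : ∀ f : ℝ → ℝ, (∀ x, 0 ≤ f x) → BddAbove (Set.range f) → 
      (∫ x, f x) = 0 ∨ ∃ M > 0, (∀ x, f x ≤ M) ∧ ∀ t < M, ∃ x, t < f x := by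
    intro f hf0 hfb
    by_cases hM : 0 < ⨆ x, f x
    · right
      exact ⟨_, hM, fun x => le_ciSup hfb x, fun t ht => exists_lt_of_lt_ciSup ht⟩
    · left
      have : ∀ x, f x = 0 := fun x => le_antisymm ((le_ciSup hfb x).trans (not_lt.1 hM)) (hf0 x)
      simp [this]
  rcases sup f hf0 hfb with h0 | ⟨M, hM, hfM, hfs⟩
  · rw [h0, Real.zero_rpow hl0.ne']; simpa using hI
  rcases sup g hg0 hgb with h0 | ⟨N, hN, hgN, hgs⟩
  · rw [h0, Real.zero_rpow hl1'.ne']; simpa using hI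
  set K := M ^ l * N ^ (1 - l) with hK
  have hK0 : 0 < K := by positivity
  have main := pl_norm (f := fun x => f x / M) (g := fun x => g x / N) (h := fun x => h x / K)
    (hf.div_const _) (hg.div_const _) (hh.div_const _)
    (fun x => div_nonneg (hf0 x) hM.le) (fun x => div_nonneg (hg0 x) hN.le)
    (fun x => div_nonneg (hh0 x) hK0.le)
    (fun x => (div_le_one hM).2 (hfM x)) (fun x => (div_le_one hN).2 (hgN x))
    (fun t ht => by
      obtain ⟨x, hx⟩ := hfs (t * M) (by nlinarith)
      exact ⟨x, (lt_div_iff₀ hM).2 hx⟩)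
    (fun t ht => by
      obtain ⟨x, hx⟩ := hgs (t * N) (by nlinarith)
      exact ⟨x, (lt_div_iff₀ hN).2 hx⟩) l hl0 hl1
    (fun x y => by
      rw [Real.div_rpow (hf0 x) hM.le, Real.div_rpow (hg0 y) hN.le, div_mul_div_comm]
      exact div_le_div_of_nonneg_right (H x y) hK0.le)
  rw [← ofReal_integral_eq_lintegral_ofReal (hfi.div_const _)
      (.of_forall fun x => div_nonneg (hf0 x) hM.le),
    ← ofReal_integral_eq_lintegral_ofReal (hgi.div_const _)
      (.of_forall fun x => div_nonneg (hg0 x) hN.le),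
    ← ofReal_integral_eq_lintegral_ofReal (hhi.div_const _)
      (.of_forall fun x => div_nonneg (hh0 x) hK0.le)] at main
  simp only [integral_div] at main
  have hIf : 0 ≤ (∫ x, f x) := integral_nonneg hf0
  have hIg : 0 ≤ (∫ x, g x) := integral_nonneg hg0
  rw [← ENNReal.ofReal_mul hl0.le, ← ENNReal.ofReal_mul hl1'.le,
    ← ENNReal.ofReal_add (by positivity) (by positivity),
    ENNReal.ofReal_le_ofReal_iff (by positivity)] at main
  have am := Real.geom_mean_le_arith_mean2_weighted hl0.le hl1'.le
    (div_nonneg hIf hM.le) (div_nonneg hIg hN.le) (by ring)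
  have := am.trans main
  rw [Real.div_rpow hIf hM.le, Real.div_rpow hIg hN.le, div_mul_div_comm] at this
  exact (div_le_div_iff_of_pos_right hK0).1 this

theorem lc_bdd {g : ℝ → ℝ} (hm : Measurable g) (h0 : ∀ x, 0 ≤ g x) (h1 : ∫ w, g w = 1)
    (hg : LogConcave g) : BddAbove (Set.range g) := by
  have hgi : Integrable g := by
    by_contra h
    rw [integral_undef h] at h1
    norm_num at h1
  set J := ∫⁻ y, ENNReal.ofReal (g y ^ (1/2 : ℝ)) with hJ
  have hJ0 : J ≠ 0 := by
    intro h
    rw [hJ, lintegral_eq_zero_iff (by fun_prop)] at h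
    have : g =ᵐ[volume] 0 := by
      filter_upwards [h] with x hx
      have hx : g x ^ (1/2 : ℝ) ≤ 0 := by simpa using hx
      have := le_antisymm hx (Real.rpow_nonneg (h0 x) _)
      exact ((Real.rpow_eq_zero_iff_of_nonneg (h0 x)).1 this).1
    rw [integral_congr_ae this] at h1
    simp at h1
  have hhalf : ∀ x, Integrable (fun y => g ((1/2) * x + (1/2) * y)) := by
    intro x
    exact (hgi.comp_add_left ((1/2) * x)).comp_mul_left' (by norm_num)
  have hint : ∀ x, ∫ y, g ((1/2) * x + (1/2) * y) = 2 := by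
    intro x
    have := Measure.integral_comp_mul_left (fun y => g ((1/2) * x + y)) (1/2)
    rw [this, integral_add_left_eq_self, h1]
    norm_num
  have key : ∀ x, ENNReal.ofReal (g x ^ (1/2 : ℝ)) * J ≤ 2 := by
    intro x
    rw [hJ, ← lintegral_const_mul' _ _ ENNReal.ofReal_ne_top]
    calc _ ≤ ∫⁻ y, ENNReal.ofReal (g ((1/2) * x + (1/2) * y)) := by
          apply lintegral_mono
          intro y
          dsimp only
          rw [← ENNReal.ofReal_mul (Real.rpow_nonneg (h0 x) _)]
          apply ENNReal.ofReal_le_ofReal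
          have := hg x y (1/2) (by norm_num) (by norm_num)
          norm_num at this ⊢
          exact this
      _ = 2 := by
          rw [← ofReal_integral_eq_lintegral_ofReal (hhalf x) (.of_forall fun y => h0 _), hint]
          norm_num
  refine ⟨((2 / J).toReal) ^ (2:ℝ), ?_⟩
  rintro _ ⟨x, rfl⟩
  have hfin : 2 / J ≠ ⊤ := ENNReal.div_ne_top (by norm_num) hJ0
  have h2 : ENNReal.ofReal (g x ^ (1/2 : ℝ)) ≤ 2 / J :=
    (ENNReal.le_div_iff_mul_le (.inl hJ0) (.inr (by norm_num))).2 (key x)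
  have h3 : g x ^ (1/2 : ℝ) ≤ (2 / J).toReal := (ENNReal.ofReal_le_iff_le_toReal hfin).1 h2
  calc g x = (g x ^ (1/2 : ℝ)) ^ (2:ℝ) := by
        rw [← Real.rpow_mul (h0 x)]; norm_num
    _ ≤ _ := Real.rpow_le_rpow (Real.rpow_nonneg (h0 x) _) h3 (by norm_num)

theorem lc_step (g φ : ℝ → ℝ) (a u : ℝ) 
    (hgm : Measurable g) (hg0 : ∀ x, 0 ≤ g x) (hg1 : ∫ w, g w = 1) (hg : LogConcave g)
    (hm : Measurable φ) (h0 : ∀ x, 0 ≤ φ x) (h1 : ∫ w, φ w = 1) (hφ : LogConcave φ) 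
    (G : ℝ → ℝ) (hG : ∀ x, G x = ∫ s, φ s * g (x - a * s - u)) :
    Measurable G ∧ (∀ x, 0 ≤ G x) ∧ (∫ x, G x) = 1 ∧ LogConcave G := by
  have hG' : G = fun x => ∫ s, φ s * g (x - a * s - u) := funext hG
  have int1 : ∀ f : ℝ → ℝ, ∫ w, f w = 1 → Integrable f := by
    intro f h1
    by_contra h
    rw [integral_undef h] at h1
    norm_num at h1
  have hgi := int1 g hg1
  have hφi := int1 φ h1
  have hgb := lc_bdd hgm hg0 hg1 hg
  have hφb := lc_bdd hm h0 h1 hφ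
  have hkm : Measurable (fun p : ℝ × ℝ => φ p.2 * g (p.1 - a * p.2 - u)) := by fun_prop
  have hk0 : ∀ x s, 0 ≤ φ s * g (x - a * s - u) := fun x s => mul_nonneg (h0 _) (hg0 _)
  have hGm : Measurable G := by
    rw [hG']
    exact (hkm.stronglyMeasurable.integral_prod_right (ν := volume)).measurable
  have hxi : ∀ s, ∫ x, φ s * g (x - a * s - u) = φ s := by
    intro s
    rw [integral_const_mul]
    have : ∫ x, g (x - a * s - u) = 1 := by
      rw [← hg1, ← integral_sub_right_eq_self g (a * s + u)]
      simp only [sub_sub]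
    rw [this, mul_one]
  have hprod : Integrable (fun p : ℝ × ℝ => φ p.2 * g (p.1 - a * p.2 - u))
      (volume.prod volume) := by
    rw [integrable_prod_iff' hkm.aestronglyMeasurable]
    constructor
    · refine .of_forall fun s => ?_
      have := (hgi.comp_sub_right (a * s + u)).const_mul (φ s)
      simpa only [sub_sub] using this
    · simp only [Real.norm_of_nonneg (hk0 _ _), hxi]
      exact hφi
  refine ⟨hGm, fun x => by rw [hG]; exact integral_nonneg (hk0 x), ?_, ?_⟩
  · rw [hG', integral_integral_swap hprod]
    simp only [hxi, h1]
  · intro x y l hl0 hl1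
    rcases hl0.eq_or_lt with rfl | hl0
    · simp
    rcases hl1.eq_or_lt with rfl | hl1
    · simp
    obtain ⟨Mg, hMg⟩ := hgb
    obtain ⟨Mφ, hMφ⟩ := hφb
    have hMg' : ∀ x, g x ≤ Mg := fun x => hMg ⟨x, rfl⟩
    have hMφ' : ∀ x, φ x ≤ Mφ := fun x => hMφ ⟨x, rfl⟩
    have km : ∀ x, Measurable (fun s => φ s * g (x - a * s - u)) := fun x => by fun_prop
    have ki : ∀ x, Integrable (fun s => φ s * g (x - a * s - u)) := by
      intro x
      refine (hφi.mul_const Mg).mono' (km x).aestronglyMeasurable (.of_forall fun s => ?_)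
      rw [Real.norm_of_nonneg (hk0 _ _)]
      exact mul_le_mul_of_nonneg_left (hMg' _) (h0 _)
    have kb : ∀ x, BddAbove (Set.range (fun s => φ s * g (x - a * s - u))) := by
      intro x
      refine ⟨Mφ * Mg, ?_⟩
      rintro _ ⟨s, rfl⟩
      exact mul_le_mul (hMφ' _) (hMg' _) (hg0 _) ((h0 0).trans (hMφ' 0))
    rw [hG, hG, hG]
    refine pl_int (km x) (km y) (km _) (hk0 x) (hk0 y) (hk0 _) (ki x) (ki y) (ki _) (kb x) (kb y)
      l hl0 hl1 ?_
    intro s r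
    rw [Real.mul_rpow (h0 _) (hg0 _), Real.mul_rpow (h0 _) (hg0 _), mul_mul_mul_comm]
    refine mul_le_mul (hφ s r l hl0.le hl1.le) ?_ ?_ (h0 _)
    · refine (hg _ _ l hl0.le hl1.le).trans_eq ?_
      congr 1
      ring
    · exact mul_nonneg (Real.rpow_nonneg (hg0 _) _) (Real.rpow_nonneg (hg0 _) _)

theorem lc_trunc (f : ℝ → ℝ) (h0 : ∀ x, 0 ≤ f x) (hf : LogConcave f) (I : Set ℝ)
    (hI : Convex ℝ I) (c : ℝ) (hc : 0 < c) : LogConcave (fun s => c * I.indicator f s) := by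
  intro x y l hl0 hl1
  rcases hl0.eq_or_lt with rfl | hl0
  · simp
  rcases hl1.eq_or_lt with rfl | hl1
  · simp
  have hl1' : 0 < 1 - l := by linarith
  have hn : ∀ z, 0 ≤ c * I.indicator f z := fun z =>
    mul_nonneg hc.le (Set.indicator_nonneg (fun x _ => h0 x) z)
  by_cases hx : x ∈ I
  · by_cases hy : y ∈ I
    · have hz : l * x + (1 - l) * y ∈ I := hI hx hy hl0.le hl1'.le (by ring)
      simp only [Set.indicator_of_mem hx, Set.indicator_of_mem hy, Set.indicator_of_mem hz]
      rw [Real.mul_rpow hc.le (h0 _), Real.mul_rpow hc.le (h0 _), mul_mul_mul_comm,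
        ← Real.rpow_add hc, add_sub_cancel, Real.rpow_one]
      exact mul_le_mul_of_nonneg_left (hf x y l hl0.le hl1.le) hc.le
    · simp only [Set.indicator_of_notMem hy, mul_zero, Real.zero_rpow hl1'.ne']
      exact hn _
  · simp only [Set.indicator_of_notMem hx, mul_zero, Real.zero_rpow hl0.ne', zero_mul]
    exact hn _

/-- **All prior densities of the greedy quantized-control scheme are log-concave.**
Let `g` be a log-concave probability density on `ℝ` and `a ≠ 0`. Define recursively
`f_1 = g` and, for `t ≥ 1`, given an interval (convex set) `I_t ⊆ ℝ` with
`γ_t = ∫_{I_t} f_t > 0` and a real `u_t`,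
`f_{t+1}(x) = ∫ γ_t⁻¹ 1_{I_t}(s) f_t(s) g(x − a·s − u_t) ds`.
Then for every `t ≥ 1`, `f_t` is a log-concave probability density on `ℝ`. -/
theorem greedy_priors_logConcave (g : ℝ → ℝ) (a : ℝ) (ha : a ≠ 0)
    (hg_meas : Measurable g) (hg0 : ∀ x, 0 ≤ g x) (hg1 : ∫ w, g w = 1)
    (hg : LogConcave g)
    (I : ℕ → Set ℝ) (hI : ∀ t, 1 ≤ t → Convex ℝ (I t))
    (u : ℕ → ℝ)
    (F : ℕ → ℝ → ℝ)
    (hF1 : F 1 = g)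
    (hγ : ∀ t, 1 ≤ t → 0 < ∫ s in I t, F t s)
    (hFrec : ∀ t, 1 ≤ t → ∀ x,
      F (t + 1) x = ∫ s, (∫ s' in I t, F t s')⁻¹ * (I t).indicator (F t) s *
        g (x - a * s - u t)) :
    ∀ t, 1 ≤ t → (∀ x, 0 ≤ F t x) ∧ (∫ x, F t x) = 1 ∧ LogConcave (F t) := by
  have main : ∀ t, 1 ≤ t → Measurable (F t) ∧ (∀ x, 0 ≤ F t x) ∧ (∫ x, F t x) = 1 ∧
      LogConcave (F t) := by
    intro t ht
    induction t, ht using Nat.le_induction with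
    | base => rw [hF1]; exact ⟨hg_meas, hg0, hg1, hg⟩
    | succ t ht ih =>
      obtain ⟨hm, h0, h1, hl⟩ := ih
      have hIm : MeasurableSet (I t) := (hI t ht).ordConnected.measurableSet
      have hc := hγ t ht
      refine lc_step g (fun s => (∫ s' in I t, F t s')⁻¹ * (I t).indicator (F t) s) a (u t)
        hg_meas hg0 hg1 hg ((hm.indicator hIm).const_mul _)
        (fun x => mul_nonneg (inv_nonneg.2 hc.le) (Set.indicator_nonneg (fun x _ => h0 x) x)) ?_
        (lc_trunc _ h0 hl _ (hI t ht) _ (inv_pos.2 hc)) _ (hFrec t ht)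
      rw [integral_const_mul, integral_indicator hIm, inv_mul_cancel₀ hc.ne']
  exact fun t ht => (main t ht).2
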